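/- Let s be a weak composition and T an s-decreasing tree with tree ascents (a,b) and (c,d), a < c, and let Z and Q be the s-tree rotations of T along (a,b) and (c,d). Suppose (a,b) is a tree ascent of Q but (c,d) is not a tree ascent of Z. Then the closed interval [T, Z ∨ Q] in s-weak order consists exactly of five elements T, Z, Q, P, Z ∨ Q (its Hasse diagram is a pentagon), with exactly two maximal chains T ⋖ Q ⋖ Z ∨ Q and T ⋖ Z ⋖ P ⋖ Z ∨ Q, whose label sequences under the labeling λ assigning to each cover relation the smaller element of its associated tree ascent are (c, a) and (a, a, c) respectively. -/

import Mathlib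

open scoped Classical

/-- An `s`-decreasing tree with internal vertices `1,…,n` (the root is `n`), encoded by
recording, for each non-root internal vertex `v`, its parent `parent v` (an internal vertex
with a larger label, so that labels decrease away from the root) and the index `idx v` of
the child slot of `parent v` (among `0,…,s (parent v)`, left to right) containing `v`.
Distinct internal vertices occupy distinct child slots; all remaining slots are leaves. -/
structure SDecTree (n : ℕ) (s : ℕ → ℕ) where
  parent : ℕ → ℕ
  idx : ℕ → ℕ
  parent_gt : ∀ v, 1 ≤ v → v < n → v < parent v
  parent_le : ∀ v, 1 ≤ v → v < n → parent v ≤ n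
  idx_le : ∀ v, 1 ≤ v → v < n → idx v ≤ s (parent v)
  slot_inj : ∀ v w, 1 ≤ v → v < n → 1 ≤ w → w < n →
      parent v = parent w → idx v = idx w → v = w
  parent_out : ∀ v, v = 0 ∨ n ≤ v → parent v = 0
  idx_out : ∀ v, v = 0 ∨ n ≤ v → idx v = 0

namespace SDecTree

variable {n : ℕ} {s : ℕ → ℕ}

/-- `y` is a weak ancestor of `x`, i.e. `x` is a labeled vertex of the subtree `T^y`. -/
def Descend (T : SDecTree n s) (x y : ℕ) : Prop :=
  ∃ k, T.parent^[k] x = y ∧ ∀ m ≤ k, 1 ≤ T.parent^[m] x ∧ T.parent^[m] x ≤ n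

/-- `x` is a labeled vertex of the subtree `T^y_j` rooted at the `j`-th child of `y`. -/
def InSub (T : SDecTree n s) (y j x : ℕ) : Prop :=
  ∃ c, T.Descend x c ∧ T.parent c = y ∧ T.idx c = j

/-- `x` lies strictly left of `y` in the planar tree `T`. -/
def LeftOf (T : SDecTree n s) (x y : ℕ) : Prop :=
  ∃ z j₁ j₂, j₁ < j₂ ∧ T.InSub z j₁ x ∧ T.InSub z j₂ y

/-- The cardinality `#_T(y,x)` of the pair `(y,x)`: it is `j` if `x ∈ T^y_j`
(so `0` if `x ∈ T^y_0` and `s y` if `x ∈ T^y_{s y}`), `0` if `x` is left of `y`, and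
`s y` if `x` is right of `y`; it is `0` for out-of-range pairs. -/
noncomputable def card (T : SDecTree n s) (y x : ℕ) : ℕ :=
  if h : ∃ j, T.InSub y j x then h.choose
  else if 1 ≤ x ∧ x < y ∧ y ≤ n ∧ ¬ T.LeftOf x y then s y else 0

/-- `x` is a labeled vertex of `T^a ∖ 0`, i.e. of `T^a` with `T^a_0` replaced by a leaf. -/
def InSubMinus0 (T : SDecTree n s) (a x : ℕ) : Prop :=
  x = a ∨ ∃ j, 0 < j ∧ T.InSub a j x

/-- `(a,b)` is a tree ascent of `T`. -/
def TreeAscent (T : SDecTree n s) (a b : ℕ) : Prop :=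
  1 ≤ a ∧ a < b ∧ b ≤ n ∧
  (∃ i, i < s b ∧ T.InSub b i a) ∧
  (∀ e j, a < e → e < b → T.InSub e j a → j = s e) ∧
  (0 < s a → ∀ x, ¬ T.InSub a (s a) x)

end SDecTree

/-- A multi-inversion set (encoded by its multiplicity function) is transitive:
if `a < b < c` then `#(b,a) = 0` or `#(c,a) ≥ #(c,b)`. -/
def IsTransitiveInv (I : ℕ → ℕ → ℕ) : Prop :=
  ∀ a b c, a < b → b < c → I b a = 0 ∨ I c b ≤ I c a

/-- The transitive closure of a multi-inversion set: the smallest (by inclusion, i.e.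
pointwise on multiplicities) transitive multi-inversion set containing it. -/
noncomputable def tcInv (I : ℕ → ℕ → ℕ) : ℕ → ℕ → ℕ := fun y x =>
  sInf {m | ∃ J : ℕ → ℕ → ℕ, IsTransitiveInv J ∧ (∀ y' x', I y' x' ≤ J y' x') ∧ J y x = m}

/-- Add one copy of the inversion `(b,a)` to `I`, capping the multiplicity at `s b`. -/
def addInv (s : ℕ → ℕ) (I : ℕ → ℕ → ℕ) (b a : ℕ) : ℕ → ℕ → ℕ := fun y x =>
  if y = b ∧ x = a then min (I y x + 1) (s y) else I y x

namespace SDecTree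

variable {n : ℕ} {s : ℕ → ℕ}

/-- The `s`-weak order: `T ⪯ Z` iff `#_T(y,x) ≤ #_Z(y,x)` for all pairs. -/
def wle (T Z : SDecTree n s) : Prop := ∀ y x, T.card y x ≤ Z.card y x

/-- Strict `s`-weak order. -/
def wlt (T Z : SDecTree n s) : Prop := wle T Z ∧ ¬ wle Z T

/-- Cover relation in the `s`-weak order. -/
def wcov (T Z : SDecTree n s) : Prop := wlt T Z ∧ ∀ U, wlt T U → wlt U Z → False

/-- `W` is the join of `T` and `Z` in the `s`-weak order. -/
def IsJoin (T Z W : SDecTree n s) : Prop :=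
  wle T W ∧ wle Z W ∧ ∀ U, wle T U → wle Z U → wle W U

/-- `Z` is the `s`-tree rotation of `T` along the tree ascent `(a,b)`, i.e.
`inv Z = (inv T + (b,a))^tc`. -/
def IsRotation (T Z : SDecTree n s) (a b : ℕ) : Prop :=
  T.TreeAscent a b ∧
  ∀ y x, 1 ≤ x → x < y → y ≤ n → Z.card y x = tcInv (addInv s T.card b a) y x

/-- The set `A_T(a,b)` of inversions added by a rotation producing `Z`: the pairs `(f,e)`
with `#_Z(f,e) > #_T(f,e)`. -/
def Aset (T Z : SDecTree n s) : Set (ℕ × ℕ) :=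
  {p | T.card p.1 p.2 < Z.card p.1 p.2}

/-- The set `A_T(a,b)` described directly via the transitive closure. -/
def ARot (T : SDecTree n s) (a b : ℕ) : Set (ℕ × ℕ) :=
  {p | T.card p.1 p.2 < tcInv (addInv s T.card b a) p.1 p.2}

/-- The set `F_T(a,c)` (here `b` and `d` are the partners of `a` and `c` in the
respective tree ascents `(a,b)` and `(c,d)`): it is `{(d,e) : e ∈ T^a∖0}` if `b = c`
and `a ∈ T^c_0`, and empty otherwise. -/
def Fset (T : SDecTree n s) (a b c d : ℕ) : Set (ℕ × ℕ) :=
  {p | b = c ∧ T.InSub c 0 a ∧ p.1 = d ∧ T.InSubMinus0 a p.2}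

/-- `T` is an `s`-Tamari tree: `#_T(c,a) ≤ #_T(c,b)` whenever `a < b < c`. -/
def IsTamari (T : SDecTree n s) : Prop :=
  ∀ a b c, a < b → b < c → T.card c a ≤ T.card c b

/-- `(a,b)` is a Tamari tree ascent of `T`: `a` is a non-rightmost child of `b`. -/
def TamariAscent (T : SDecTree n s) (a b : ℕ) : Prop :=
  1 ≤ a ∧ a < n ∧ T.parent a = b ∧ T.card b a < s b

/-- `Z` is the `s`-Tamari rotation of `T` along the Tamari tree ascent `(a,b)`. -/
def IsTamRotation (T Z : SDecTree n s) (a b : ℕ) : Prop :=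
  T.TamariAscent a b ∧
  ∀ y x, 1 ≤ x → x < y → y ≤ n → Z.card y x = tcInv (addInv s T.card b a) y x

/-- Cover relation in the `s`-Tamari lattice. -/
def tamcov (T Z : SDecTree n s) : Prop :=
  IsTamari T ∧ IsTamari Z ∧ wlt T Z ∧ ∀ U, IsTamari U → wlt T U → wlt U Z → False

/-- `W` is the join of `T` and `Z` in the `s`-Tamari lattice. -/
def IsTamJoin (T Z W : SDecTree n s) : Prop :=
  IsTamari W ∧ wle T W ∧ wle Z W ∧ ∀ U, IsTamari U → wle T U → wle Z U → wle W U

/-- The open interval `(T,Z)` in the `s`-weak order. -/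
def OpenInterval (T Z : SDecTree n s) : Set (SDecTree n s) := {U | wlt T U ∧ wlt U Z}

/-- A set of trees forming a chain in the `s`-weak order. -/
def IsChainSet (C : Set (SDecTree n s)) : Prop :=
  C.Pairwise fun U V => wlt U V ∨ wlt V U

/-- The geometric realization of the order complex `Δ(T,Z)` of the open interval `(T,Z)`
in the `s`-weak order: the space of finitely supported probability vectors on the vertex
set whose support is a chain of the open interval. -/
def orderComplex (T Z : SDecTree n s) : Set (SDecTree n s → ℝ) :=
  {f | (∀ U, 0 ≤ f U) ∧ (Function.support f).Finite ∧
    Function.support f ⊆ OpenInterval T Z ∧ IsChainSet (Function.support f) ∧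
    ∑ᶠ U, f U = 1}

/-- The geometric realization of the order complex of the open interval `(T,Z)` in the
`s`-Tamari lattice. -/
def tamOrderComplex (T Z : SDecTree n s) : Set (SDecTree n s → ℝ) :=
  {f | (∀ U, 0 ≤ f U) ∧ (Function.support f).Finite ∧
    Function.support f ⊆ {U | IsTamari U ∧ wlt T U ∧ wlt U Z} ∧
    IsChainSet (Function.support f) ∧ ∑ᶠ U, f U = 1}

end SDecTree

/-- The list of labels of the consecutive cover relations along a saturated chain,
recorded as a list of poset elements. -/
def labelsOf {α : Type*} (lab : α → α → ℕ) (L : List α) : List ℕ :=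
  (L.zip L.tail).map fun p => lab p.1 p.2

namespace SDecTree

variable {n : ℕ} {s : ℕ → ℕ}

theorem descend_iff (T : SDecTree n s) (x y : ℕ) :
    T.Descend x y ↔ (x = y ∧ 1 ≤ x ∧ x ≤ n) ∨ (1 ≤ x ∧ x < n ∧ T.Descend (T.parent x) y) := by
  constructor
  · rintro ⟨k, hk, hm⟩
    cases k with
    | zero => left; exact ⟨hk, hm 0 le_rfl⟩
    | succ k =>
      right
      have h0 := hm 0 (by omega)
      have h1 := hm 1 (by omega)
      simp only [Function.iterate_zero, id, Function.iterate_one] at h0 h1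
      refine ⟨h0.1, ?_, k, ?_, ?_⟩
      · by_contra hc
        have := T.parent_out x (Or.inr (by omega))
        omega
      · rw [← hk, Function.iterate_succ_apply]
      · intro m hmk
        rw [← Function.iterate_succ_apply]
        exact hm (m+1) (by omega)
  · rintro (⟨h, h1, h2⟩ | ⟨h1, h2, k, hk, hm⟩)
    · refine ⟨0, h, ?_⟩
      intro m hm
      obtain rfl : m = 0 := by omega
      exact ⟨h1, h2⟩
    · refine ⟨k+1, ?_, ?_⟩
      · rw [Function.iterate_succ_apply]; exact hk
      · intro m hmk
        cases m with
        | zero => exact ⟨h1, h2.le⟩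
        | succ m => rw [Function.iterate_succ_apply]; exact hm m (by omega)

/-- induction from the root downwards -/
theorem up_induct (T : SDecTree n s) {p : ℕ → Prop} (h : ∀ x, 1 ≤ x → x ≤ n →
    (x < n → p (T.parent x)) → p x) : ∀ x, 1 ≤ x → x ≤ n → p x := by
  have : ∀ k x, n - x = k → 1 ≤ x → x ≤ n → p x := by
    intro k
    induction k using Nat.strong_induction_on with
    | _ k ih =>
      intro x hk h1 h2
      refine h x h1 h2 fun hx => ?_
      have ha := T.parent_gt x h1 hx
      have hb := T.parent_le x h1 hx
      exact ih (n - T.parent x) (by omega) _ rfl (by omega) hb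
  intro x; exact this _ x rfl

theorem Descend.left_range {T : SDecTree n s} {x y : ℕ} (h : T.Descend x y) : 1 ≤ x ∧ x ≤ n := by
  rw [descend_iff] at h; omega

theorem Descend.le {T : SDecTree n s} {x y : ℕ} (h : T.Descend x y) : x ≤ y ∧ y ≤ n := by
  have hr := h.left_range
  revert h
  refine T.up_induct (p := fun x => T.Descend x y → x ≤ y ∧ y ≤ n) ?_ x hr.1 hr.2
  intro x h1 h2 ih h
  rw [descend_iff] at h
  rcases h with h | ⟨_, h3, h⟩
  · omega
  · have := ih h3 h
    have := T.parent_gt x h1 h3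
    omega

theorem inSub_iff (T : SDecTree n s) {y j x : ℕ} (hy : 1 ≤ y) :
    T.InSub y j x ↔ 1 ≤ x ∧ x < n ∧
      ((T.parent x = y ∧ T.idx x = j) ∨ T.InSub y j (T.parent x)) := by
  constructor
  · rintro ⟨c, hc, h1, h2⟩
    have hr := hc.left_range
    rw [descend_iff] at hc
    rcases hc with ⟨rfl, h3, h4⟩ | ⟨h3, h4, h5⟩
    · refine ⟨h3, ?_, Or.inl ⟨h1, h2⟩⟩
      by_contra hh
      have := T.parent_out x (Or.inr (by omega))
      omega
    · exact ⟨h3, h4, Or.inr ⟨c, h5, h1, h2⟩⟩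
  · rintro ⟨h1, h2, ⟨h3, h4⟩ | ⟨c, hc, h3, h4⟩⟩
    · exact ⟨x, (T.descend_iff x x).2 (Or.inl ⟨rfl, h1, h2.le⟩), h3, h4⟩
    · exact ⟨c, (T.descend_iff x c).2 (Or.inr ⟨h1, h2, hc⟩), h3, h4⟩

theorem InSub.lt {T : SDecTree n s} {y j x : ℕ} (hy : 1 ≤ y) (h : T.InSub y j x) :
    1 ≤ x ∧ x < y ∧ y ≤ n ∧ j ≤ s y := by
  obtain ⟨c, hc, h1, h2⟩ := h
  have := hc.left_range
  have := hc.le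
  by_cases hcn : n ≤ c
  · have := T.parent_out c (Or.inr hcn)
    omega
  · have := T.parent_gt c (by omega) (by omega)
    have := T.parent_le c (by omega) (by omega)
    have := T.idx_le c (by omega) (by omega)
    subst h1 h2
    omega

theorem InSub.uniq {T : SDecTree n s} {y j k x : ℕ} (hy : 1 ≤ y) (h : T.InSub y j x)
    (h' : T.InSub y k x) : j = k := by
  have hl := h.lt hy
  revert h h'
  refine T.up_induct (p := fun x => T.InSub y j x → T.InSub y k x → j = k) ?_ x hl.1 (by omega)
  intro x h1 h2 ih h h'
  rw [inSub_iff T hy] at h h'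
  obtain ⟨_, h3, h⟩ := h
  obtain ⟨_, _, h'⟩ := h'
  rcases h with h | h <;> rcases h' with h' | h'
  · omega
  · have := h'.lt hy; omega
  · have := h.lt hy; omega
  · exact ih h3 h h'

theorem InSub.trans {T : SDecTree n s} {y j k x z : ℕ} (hy : 1 ≤ y) (h : T.InSub y j x)
    (h' : T.InSub z k y) : T.InSub z k x := by
  have hl := h.lt hy
  by_cases hz : z = 0
  · subst hz
    obtain ⟨c, hc, h1, h2⟩ := h'
    have hcn : n ≤ c := by
      by_contra hh
      have := T.parent_gt c (by have := hc.left_range; have := hc.le; omega) (by omega)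
      omega
    have := T.idx_out c (Or.inr hcn)
    have hcn' : c = n := by have := hc.le; omega
    refine ⟨n, ?_, hcn' ▸ h1, hcn' ▸ h2⟩
    refine T.up_induct (p := fun x => T.Descend x n) ?_ x hl.1 (by omega)
    intro x h1 h2 ih
    rw [descend_iff]
    by_cases hx : x = n
    · left; omega
    · right; exact ⟨h1, by omega, ih (by omega)⟩
  · have hz : 1 ≤ z := by omega
    revert h
    refine T.up_induct (p := fun x => T.InSub y j x → T.InSub z k x) ?_ x hl.1 (by omega)
    intro x h1 h2 ih h
    rw [inSub_iff T hy] at h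
    rw [inSub_iff T hz]
    obtain ⟨_, h3, h⟩ := h
    refine ⟨h1, h3, Or.inr ?_⟩
    rcases h with h | h
    · rw [h.1]; exact h'
    · exact ih h3 h

theorem InSub.compare {T : SDecTree n s} {y j k x z : ℕ} (hy : 1 ≤ y) (hz : 1 ≤ z)
    (h : T.InSub y j x) (h' : T.InSub z k x) : y = z ∨ T.InSub z k y ∨ T.InSub y j z := by
  have hl := h.lt hy
  revert h h'
  refine T.up_induct (p := fun x => T.InSub y j x → T.InSub z k x →
    y = z ∨ T.InSub z k y ∨ T.InSub y j z) ?_ x hl.1 (by omega)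
  intro x h1 h2 ih h h'
  rw [inSub_iff T hy] at h
  rw [inSub_iff T hz] at h'
  obtain ⟨_, h3, h⟩ := h
  obtain ⟨_, _, h'⟩ := h'
  rcases h with h | h <;> rcases h' with h' | h'
  · omega
  · right; left; rw [← h.1]; exact h'
  · right; right; rw [← h'.1]; exact h
  · exact ih h3 h h'

theorem inSub_root (T : SDecTree n s) {x : ℕ} (h1 : 1 ≤ x) (h2 : x < n) : ∃ j, T.InSub n j x := by
  have : x < n → ∃ j, T.InSub n j x := by
    refine T.up_induct (p := fun x => x < n → ∃ j, T.InSub n j x) ?_ x h1 h2.le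
    intro x h1 h2 ih h
    have := T.parent_le x h1 h
    by_cases hp : T.parent x = n
    · exact ⟨T.idx x, (inSub_iff T (by omega)).2 ⟨h1, h, Or.inl ⟨hp, rfl⟩⟩⟩
    · obtain ⟨j, hj⟩ := ih h (by omega)
      exact ⟨j, (inSub_iff T (by omega)).2 ⟨h1, h, Or.inr hj⟩⟩
  exact this h2

theorem inSub_parent (T : SDecTree n s) {x : ℕ} (h1 : 1 ≤ x) (h2 : x < n) :
    T.InSub (T.parent x) (T.idx x) x :=
  ⟨x, (T.descend_iff x x).2 (Or.inl ⟨rfl, h1, h2.le⟩), rfl, rfl⟩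

theorem tricho (T : SDecTree n s) {x y : ℕ} (hx1 : 1 ≤ x) (hx2 : x ≤ n) (hy1 : 1 ≤ y) (hy2 : y ≤ n) :
    x = y ∨ (∃ j, T.InSub y j x) ∨ (∃ j, T.InSub x j y) ∨
      ∃ z j k, 1 ≤ z ∧ j ≠ k ∧ T.InSub z j x ∧ T.InSub z k y := by
  refine T.up_induct (p := fun x => x = y ∨ (∃ j, T.InSub y j x) ∨ (∃ j, T.InSub x j y) ∨
      ∃ z j k, 1 ≤ z ∧ j ≠ k ∧ T.InSub z j x ∧ T.InSub z k y) ?_ x hx1 hx2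
  intro x h1 h2 ih
  by_cases hxn : x = n
  · subst hxn
    by_cases hy : y = x
    · left; exact hy.symm
    · right; right; left
      exact T.inSub_root hy1 (by omega)
  · have hx : x < n := by omega
    have hp := T.inSub_parent h1 hx
    have hpg := T.parent_gt x h1 hx
    rcases ih hx with h | ⟨j, h⟩ | ⟨j, h⟩ | ⟨z, j, k, hz, hjk, h, h'⟩
    · right; left; exact ⟨_, h ▸ hp⟩
    · right; left; exact ⟨j, hp.trans (by omega) h⟩
    · by_cases hj : T.idx x = j
      · obtain ⟨c, hc, h3, h4⟩ := h
        have hcn : c < n := by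
          by_contra hh
          have := T.parent_out c (Or.inr (by omega))
          omega
        have hc1 : 1 ≤ c := by have := hc.le; omega
        have hcx : c = x := T.slot_inj c x hc1 hcn h1 hx h3 (by omega)
        subst hcx
        by_cases hyc : y = c
        · left; exact hyc.symm
        right; right; left
        have : ∀ y, 1 ≤ y → y ≤ n → (y ≠ c → T.Descend y c → ∃ j, T.InSub c j y) := by
          refine T.up_induct ?_
          intro y h1 h2 ih hne hd
          rw [descend_iff] at hd
          rcases hd with hd | ⟨_, hyn, hd⟩
          · exact absurd hd.1 hne
          · by_cases hpc : T.parent y = c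
            · exact ⟨_, hpc ▸ T.inSub_parent h1 hyn⟩
            · obtain ⟨j, hj⟩ := ih hyn hpc hd
              exact ⟨j, (inSub_iff T hc1).2 ⟨h1, hyn, Or.inr hj⟩⟩
        exact this y hy1 hy2 hyc hc
      · right; right; right
        exact ⟨_, _, _, by omega, hj, hp, h⟩
    · right; right; right
      exact ⟨z, j, k, hz, hjk, hp.trans (by omega) h, h'⟩

theorem LeftOf.pos {T : SDecTree n s} {x y : ℕ} (h : T.LeftOf x y) :
    ∃ z j₁ j₂, 1 ≤ z ∧ j₁ < j₂ ∧ T.InSub z j₁ x ∧ T.InSub z j₂ y := by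
  obtain ⟨z, j₁, j₂, h1, h2, h3⟩ := h
  refine ⟨z, j₁, j₂, ?_, h1, h2, h3⟩
  by_contra hz
  obtain rfl : z = 0 := by omega
  obtain ⟨c, hc, h4, h5⟩ := h3
  by_cases hcn : n ≤ c
  · have := T.idx_out c (Or.inr hcn)
    omega
  · have := T.parent_gt c (by have := hc.left_range; have := hc.le; omega) (by omega)
    omega

theorem LeftOf.not_inSub {T : SDecTree n s} {x y j : ℕ} (hy : 1 ≤ y) (h : T.LeftOf x y) :
    ¬ T.InSub y j x := by
  obtain ⟨z, j₁, j₂, hz, h1, h2, h3⟩ := h.pos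
  intro h4
  have := (h4.trans hy h3).uniq hz h2
  omega

theorem LeftOf.not_inSub' {T : SDecTree n s} {x y j : ℕ} (hy : 1 ≤ y) (h : T.LeftOf y x) :
    ¬ T.InSub y j x := by
  obtain ⟨z, j₁, j₂, hz, h1, h2, h3⟩ := h.pos
  intro h4
  have := (h4.trans hy h2).uniq hz h3
  omega

theorem LeftOf.trans {T : SDecTree n s} {x y w : ℕ} (h : T.LeftOf x y) (h' : T.LeftOf y w) :
    T.LeftOf x w := by
  obtain ⟨z, j₁, j₂, hz, h1, h2, h3⟩ := h.pos
  obtain ⟨z', k₁, k₂, hz', h1', h2', h3'⟩ := h'.pos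
  rcases h3.compare hz hz' h2' with rfl | h4 | h4
  · have := h3.uniq hz h2'
    exact ⟨z, j₁, k₂, by omega, h2, h3'⟩
  · exact ⟨z', k₁, k₂, h1', h2.trans hz h4, h3'⟩
  · exact ⟨z, j₁, j₂, h1, h2, h3'.trans hz' h4⟩

theorem LeftOf.irrefl {T : SDecTree n s} {x : ℕ} : ¬ T.LeftOf x x := by
  intro h
  obtain ⟨z, j₁, j₂, hz, h1, h2, h3⟩ := h.pos
  have := h2.uniq hz h3
  omega

theorem card_of_inSub {T : SDecTree n s} {x y j : ℕ} (hy : 1 ≤ y) (h : T.InSub y j x) :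
    T.card y x = j := by
  have hex : ∃ j, T.InSub y j x := ⟨j, h⟩
  unfold card
  rw [dif_pos hex]
  exact hex.choose_spec.uniq hy h

theorem card_of_left {T : SDecTree n s} {x y : ℕ} (hy : 1 ≤ y) (h : T.LeftOf x y) :
    T.card y x = 0 := by
  unfold card
  rw [dif_neg, if_neg]
  · tauto
  · rintro ⟨j, hj⟩; exact h.not_inSub hy hj

theorem card_of_right {T : SDecTree n s} {x y : ℕ} (hx : 1 ≤ x) (hxy : x < y) (hyn : y ≤ n)
    (h : T.LeftOf y x) : T.card y x = s y := by
  unfold card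
  rw [dif_neg, if_pos]
  · exact ⟨hx, hxy, hyn, fun h' => LeftOf.irrefl (h.trans h')⟩
  · rintro ⟨j, hj⟩; exact h.not_inSub' (by omega) hj

theorem card_out {T : SDecTree n s} {x y : ℕ} (h : ¬ (1 ≤ x ∧ x < y ∧ y ≤ n)) :
    T.card y x = 0 := by
  unfold card
  split_ifs with h1 h2
  · have hh := h1.choose_spec
    by_cases hy : 1 ≤ y
    · have := hh.lt hy
      omega
    · obtain ⟨c, hc, h4, h5⟩ := hh
      rw [← h5]
      apply T.idx_out
      by_contra hcn
      have := T.parent_gt c (by omega) (by omega)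
      omega
  · omega
  · rfl

theorem tri3 (T : SDecTree n s) {x y : ℕ} (hx : 1 ≤ x) (hxy : x < y) (hyn : y ≤ n) :
    (∃ j, T.InSub y j x) ∨ T.LeftOf x y ∨ T.LeftOf y x := by
  rcases T.tricho hx (by omega) (by omega) hyn with h | h | ⟨j, h⟩ | ⟨z, j, k, hz, hjk, h, h'⟩
  · omega
  · exact Or.inl h
  · have := h.lt hx; omega
  · right
    rcases lt_or_gt_of_ne hjk with hl | hl
    · left; exact ⟨z, j, k, hl, h, h'⟩
    · right; exact ⟨z, k, j, hl, h', h⟩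

theorem card_le (T : SDecTree n s) (y x : ℕ) : T.card y x ≤ s y := by
  by_cases h : 1 ≤ x ∧ x < y ∧ y ≤ n
  · rcases T.tri3 h.1 h.2.1 h.2.2 with ⟨j, h1⟩ | h1 | h1
    · rw [card_of_inSub (by omega) h1]; exact (h1.lt (by omega)).2.2.2
    · rw [card_of_left (by omega) h1]; omega
    · rw [card_of_right h.1 h.2.1 h.2.2 h1]
  · rw [card_out h]; omega

theorem card_eq_of_inSub {T : SDecTree n s} {x y j z : ℕ} (hy : 1 ≤ y) (h : T.InSub y j x)
    (hz : y < z) : T.card z x = T.card z y := by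
  have hl := h.lt hy
  by_cases hzn : z ≤ n
  · rcases T.tri3 hy hz hzn with ⟨k, h1⟩ | h1 | h1
    · rw [card_of_inSub (by omega) h1, card_of_inSub (by omega) (h.trans hy h1)]
    · rw [card_of_left (by omega) h1, card_of_left (by omega)]
      obtain ⟨w, j₁, j₂, h1, h2, h3⟩ := h1
      exact ⟨w, j₁, j₂, h1, h.trans hy h2, h3⟩
    · rw [card_of_right hy hz hzn h1, card_of_right hl.1 (by omega) hzn]
      obtain ⟨w, j₁, j₂, h1, h2, h3⟩ := h1
      exact ⟨w, j₁, j₂, h1, h2, h.trans hy h3⟩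
  · rw [card_out (by omega), card_out (by omega)]

theorem card_trans (T : SDecTree n s) : IsTransitiveInv T.card := by
  intro a b c hab hbc
  by_cases hr : 1 ≤ a ∧ c ≤ n
  swap
  · by_cases ha : 1 ≤ a
    · right; rw [card_out (y := c) (by omega)]; omega
    · left; exact card_out (by omega)
  rcases T.tri3 hr.1 hab (by omega) with ⟨j, h1⟩ | h1 | h1
  · right; rw [card_eq_of_inSub (by omega) h1 hbc]
  · left; exact card_of_left (by omega) h1
  right
  rcases T.tri3 (by omega) hbc hr.2 with ⟨j, h2⟩ | h2 | h2
  · obtain ⟨z, j₁, j₂, hz, h3, h4, h5⟩ := h1.pos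
    rcases h2.compare (by omega) hz h4 with rfl | h6 | h6
    · rw [card_of_inSub (by omega) h4, card_of_inSub (by omega) h5]; omega
    · rw [card_of_right (x := a) hr.1 (by omega) hr.2 ⟨z, j₁, j₂, h3, h6, h5⟩]
      exact T.card_le _ _
    · rw [card_of_inSub (by omega) h2, card_of_inSub (by omega) (h5.trans hz h6)]
  · rw [card_of_left (by omega) h2]; omega
  · rw [card_of_right (x := a) hr.1 (by omega) hr.2 (h2.trans h1)]
    exact T.card_le _ _

theorem card_planar (T : SDecTree n s) (a b c : ℕ) (hab : a < b) (hbc : b < c) :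
    T.card b a = s b ∨ T.card c a ≤ T.card c b := by
  by_cases hr : 1 ≤ a ∧ c ≤ n
  swap
  · right; rw [card_out (x := a) (by omega)]; omega
  rcases T.tri3 hr.1 hab (by omega) with ⟨j, h1⟩ | h1 | h1
  · right; rw [card_eq_of_inSub (by omega) h1 hbc]
  swap
  · left; exact card_of_right hr.1 hab (by omega) h1
  right
  rcases T.tri3 (by omega) hbc hr.2 with ⟨j, h2⟩ | h2 | h2
  · obtain ⟨z, j₁, j₂, hz, h3, h4, h5⟩ := h1.pos
    rcases h2.compare (by omega) hz h5 with rfl | h6 | h6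
    · rw [card_of_inSub (by omega) h4, card_of_inSub (by omega) h5]; omega
    · rw [card_of_left (x := a) (by omega) ⟨z, j₁, j₂, h3, h4, h6⟩]
      omega
    · rw [card_of_inSub (by omega) h2, card_of_inSub (by omega) (h4.trans hz h6)]
  · rw [card_of_left (x := a) (by omega) (h1.trans h2)]; omega
  · rw [card_of_right (x := b) (by omega) (by omega) hr.2 h2]
    exact T.card_le _ _

end SDecTree

/-- `x` is a strict descendant of `y`, read off the multiplicity function. -/
def Anc (n : ℕ) (I : ℕ → ℕ → ℕ) (x y : ℕ) : Prop :=
  1 ≤ x ∧ x < y ∧ y ≤ n ∧ ∀ z, y < z → I z x = I z y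

/-- tree-inversion sets -/
structure InvOK (n : ℕ) (s : ℕ → ℕ) (I : ℕ → ℕ → ℕ) : Prop where
  out : ∀ y x, ¬ (1 ≤ x ∧ x < y ∧ y ≤ n) → I y x = 0
  le : ∀ y x, I y x ≤ s y
  tr : ∀ a b c, a < b → b < c → I b a = 0 ∨ I c b ≤ I c a
  pl : ∀ a b c, a < b → b < c → I b a = s b ∨ I c a ≤ I c b

namespace SDecTree

variable {n : ℕ} {s : ℕ → ℕ}

theorem ok (T : SDecTree n s) : InvOK n s T.card :=
  ⟨fun _ _ h => card_out h, T.card_le, T.card_trans, T.card_planar⟩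

theorem inSub_iff_anc (T : SDecTree n s) {y j x : ℕ} (hy : 1 ≤ y) :
    T.InSub y j x ↔ Anc n T.card x y ∧ T.card y x = j := by
  constructor
  · intro h
    have hl := h.lt hy
    exact ⟨⟨hl.1, hl.2.1, hl.2.2.1, fun z hz => card_eq_of_inSub hy h hz⟩, card_of_inSub hy h⟩
  · rintro ⟨⟨h1, h2, h3, h4⟩, h5⟩
    have key : ∀ z j k, 1 ≤ z → T.InSub z j x → T.InSub z k y → j ≠ k → False := by
      intro z j k hz hx hyk hjk
      have := h4 z (hyk.lt hz).2.1
      rw [card_of_inSub hz hx, card_of_inSub hz hyk] at this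
      exact hjk this
    rcases T.tri3 h1 h2 h3 with ⟨k, h⟩ | h | h
    · rw [card_of_inSub hy h] at h5
      exact h5 ▸ h
    · obtain ⟨z, j₁, j₂, hz, h6, h7, h8⟩ := h.pos
      exact (key z j₁ j₂ hz h7 h8 (by omega)).elim
    · obtain ⟨z, j₁, j₂, hz, h6, h7, h8⟩ := h.pos
      exact (key z j₂ j₁ hz h8 h7 (by omega)).elim

theorem parent_le_of_anc (T : SDecTree n s) {y x : ℕ} (h : Anc n T.card x y) : T.parent x ≤ y := by
  have hy : 1 ≤ y := by have := h.1; have := h.2.1; omega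
  have := (T.inSub_iff_anc hy).2 ⟨h, rfl⟩
  rw [inSub_iff T hy] at this
  rcases this.2.2 with h1 | h1
  · omega
  · have := h1.lt hy; omega

theorem anc_parent (T : SDecTree n s) {x : ℕ} (h1 : 1 ≤ x) (h2 : x < n) :
    Anc n T.card x (T.parent x) ∧ T.card (T.parent x) x = T.idx x := by
  have := T.parent_gt x h1 h2
  exact (T.inSub_iff_anc (by omega)).1 (T.inSub_parent h1 h2)

theorem ext_card {T U : SDecTree n s} (h : T.card = U.card) : T = U := by
  have hp : T.parent = U.parent := by
    funext x
    by_cases hx : 1 ≤ x ∧ x < n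
    · have h1 := (T.anc_parent hx.1 hx.2).1
      have h2 := (U.anc_parent hx.1 hx.2).1
      rw [h] at h1
      rw [← h] at h2
      exact le_antisymm (T.parent_le_of_anc h2) (U.parent_le_of_anc h1)
    · rw [T.parent_out x (by omega), U.parent_out x (by omega)]
  have hi : T.idx = U.idx := by
    funext x
    by_cases hx : 1 ≤ x ∧ x < n
    · have h1 := (T.anc_parent hx.1 hx.2).2
      have h2 := (U.anc_parent hx.1 hx.2).2
      rw [← h1, ← h2, hp, h]
    · rw [T.idx_out x (by omega), U.idx_out x (by omega)]
  cases T; cases U; simp at hp hi; subst hp hi; rfl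

end SDecTree
section functional

variable {n : ℕ} {s : ℕ → ℕ} {I : ℕ → ℕ → ℕ}

theorem Anc.trans {x y z : ℕ} (h : Anc n I x y) (h' : Anc n I y z) : Anc n I x z :=
  ⟨h.1, h.2.1.trans h'.2.1, h'.2.2.1, fun w hw => by
    rw [h.2.2.2 w (h'.2.1.trans hw), h'.2.2.2 w hw]⟩

theorem InvOK.root (ok : InvOK n s I) {x : ℕ} (h1 : 1 ≤ x) (h2 : x < n) : Anc n I x n :=
  ⟨h1, h2, le_rfl, fun z hz => by rw [ok.out z x (by omega), ok.out z n (by omega)]⟩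

theorem InvOK.lca (ok : InvOK n s I) {v w : ℕ} (hv : 1 ≤ v) (hvw : v < w) (hw : w ≤ n) :
    Anc n I v w ∨ ∃ z, w < z ∧ Anc n I v z ∧ Anc n I w z ∧ I z v ≠ I z w := by
  by_cases h : Anc n I v w
  · exact Or.inl h
  right
  have : ∃ z, w < z ∧ I z v ≠ I z w := by
    by_contra hc
    push Not at hc
    exact h ⟨hv, hvw, hw, hc⟩
  obtain ⟨z₀, hz0, hz1⟩ := this
  have hb : ∀ z, w < z ∧ I z v ≠ I z w → z ≤ n := by
    rintro z ⟨h1, h2⟩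
    by_contra hc
    exact h2 (by rw [ok.out z v (by omega), ok.out z w (by omega)])
  have hspec := Nat.findGreatest_spec (P := fun z => w < z ∧ I z v ≠ I z w)
    (hb z₀ ⟨hz0, hz1⟩) ⟨hz0, hz1⟩
  have hmax : ∀ z', Nat.findGreatest (fun z => w < z ∧ I z v ≠ I z w) n < z' →
      ¬ (w < z' ∧ I z' v ≠ I z' w) := by
    intro z' hz' hc
    exact Nat.findGreatest_is_greatest (P := fun z => w < z ∧ I z v ≠ I z w) hz' (hb z' hc) hc
  generalize Nat.findGreatest (fun z => w < z ∧ I z v ≠ I z w) n = z at hspec hmax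
  have hzn := hb z hspec
  have heq : ∀ z', z < z' → I z' v = I z' w := by
    intro z' hz'
    by_contra hc
    exact hmax z' hz' ⟨by omega, hc⟩
  have hav : Anc n I v z := by
    refine ⟨hv, by omega, hzn, fun z' hz' => ?_⟩
    by_contra hc
    have h1 := ok.tr v z z' (by omega) hz'
    have h2 := ok.tr w z z' (by omega) hz'
    have h3 := ok.pl v z z' (by omega) hz'
    have h4 := ok.pl w z z' (by omega) hz'
    have h5 := heq z' hz'
    omega
  refine ⟨z, hspec.1, hav, ⟨by omega, hspec.1, hzn, fun z' hz' => ?_⟩, hspec.2⟩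
  rw [← heq z' hz', hav.2.2.2 z' hz']

theorem InvOK.exists_anc (ok : InvOK n s I) {x : ℕ} (h : 1 ≤ x ∧ x < n) : ∃ y, Anc n I x y :=
  ⟨n, ok.root h.1 h.2⟩

/-- the tree of a tree-inversion set -/
noncomputable def treeOf (ok : InvOK n s I) : SDecTree n s where
  parent x := if h : 1 ≤ x ∧ x < n then Nat.find (ok.exists_anc h) else 0
  idx x := if h : 1 ≤ x ∧ x < n then I (Nat.find (ok.exists_anc h)) x else 0
  parent_gt x h1 h2 := by
    rw [dif_pos ⟨h1, h2⟩]
    exact (Nat.find_spec (ok.exists_anc ⟨h1, h2⟩)).2.1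
  parent_le x h1 h2 := by
    rw [dif_pos ⟨h1, h2⟩]
    exact (Nat.find_spec (ok.exists_anc ⟨h1, h2⟩)).2.2.1
  idx_le x h1 h2 := by
    rw [dif_pos ⟨h1, h2⟩, dif_pos ⟨h1, h2⟩]
    exact ok.le _ _
  slot_inj := by
    have key : ∀ v w, 1 ≤ v → v < w → w < n → ∀ y, Anc n I v y → Anc n I w y →
        (∀ y', Anc n I v y' → y ≤ y') → (∀ y', Anc n I w y' → y ≤ y') → I y v ≠ I y w := by
      intro v w hv hvw hw y hay haw hmv hmw hI
      rcases ok.lca hv hvw hw.le with h | ⟨z, hz, h1, h2, h3⟩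
      · have := hmv w h
        have := haw.2.1
        omega
      · have := hmv z h1
        rcases Nat.lt_or_ge y z with h4 | h4
        · exact h3 (by rw [hay.2.2.2 z h4, haw.2.2.2 z h4])
        · obtain rfl : y = z := by omega
          exact h3 hI
    intro v w hv1 hv2 hw1 hw2 hp hi
    simp only [dif_pos (And.intro hv1 hv2), dif_pos (And.intro hw1 hw2)] at hp hi
    have sv := Nat.find_spec (ok.exists_anc ⟨hv1, hv2⟩)
    have sw := Nat.find_spec (ok.exists_anc ⟨hw1, hw2⟩)
    have mv := fun y' hy => Nat.find_min' (ok.exists_anc ⟨hv1, hv2⟩) (m := y') hy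
    have mw := fun y' hy => Nat.find_min' (ok.exists_anc ⟨hw1, hw2⟩) (m := y') hy
    rw [← hp] at hi sw mw
    rcases Nat.lt_trichotomy v w with h | h | h
    · exact (key v w hv1 h hw2 _ sv sw mv mw hi).elim
    · exact h
    · exact (key w v hw1 h hv2 _ sw sv mw mv hi.symm).elim
  parent_out x h := by rw [dif_neg (by omega)]
  idx_out x h := by rw [dif_neg (by omega)]

theorem treeOf_inSub (ok : InvOK n s I) {y j : ℕ} (hy : 1 ≤ y) {x : ℕ} (hx1 : 1 ≤ x) (hx2 : x ≤ n) :
    (treeOf ok).InSub y j x ↔ Anc n I x y ∧ I y x = j := by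
  refine (treeOf ok).up_induct (p := fun x => (treeOf ok).InSub y j x ↔ Anc n I x y ∧ I y x = j)
    ?_ x hx1 hx2
  intro x h1 h2 ih
  rw [SDecTree.inSub_iff _ hy]
  by_cases hx : x < n
  swap
  · constructor
    · rintro ⟨_, h, _⟩; omega
    · rintro ⟨⟨_, h3, h4, _⟩, _⟩; omega
  have ih := ih hx
  have hsp : Anc n I x ((treeOf ok).parent x) := by
    have : (treeOf ok).parent x = Nat.find (ok.exists_anc ⟨h1, hx⟩) := dif_pos ⟨h1, hx⟩
    rw [this]
    exact Nat.find_spec (ok.exists_anc ⟨h1, hx⟩)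
  have hmin : ∀ y', Anc n I x y' → (treeOf ok).parent x ≤ y' := by
    have : (treeOf ok).parent x = Nat.find (ok.exists_anc ⟨h1, hx⟩) := dif_pos ⟨h1, hx⟩
    rw [this]
    exact fun y' hy => Nat.find_min' _ hy
  have hidx : (treeOf ok).idx x = I ((treeOf ok).parent x) x := by
    have e1 : (treeOf ok).parent x = Nat.find (ok.exists_anc ⟨h1, hx⟩) := dif_pos ⟨h1, hx⟩
    have e2 : (treeOf ok).idx x = I (Nat.find (ok.exists_anc ⟨h1, hx⟩)) x := dif_pos ⟨h1, hx⟩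
    rw [e1, e2]
  generalize (treeOf ok).parent x = p at *
  constructor
  · rintro ⟨_, _, ⟨rfl, h⟩ | h⟩
    · exact ⟨hsp, by omega⟩
    · rw [ih] at h
      refine ⟨hsp.trans h.1, ?_⟩
      rw [hsp.2.2.2 y h.1.2.1]; exact h.2
  · rintro ⟨h3, h4⟩
    refine ⟨h1, hx, ?_⟩
    rcases Nat.lt_or_ge p y with h5 | h5
    · right
      rw [ih]
      refine ⟨⟨by have := hsp.2.1; omega, h5, h3.2.2.1, fun z hz => ?_⟩, ?_⟩
      · rw [← hsp.2.2.2 z (by omega), h3.2.2.2 z hz]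
      · rw [← hsp.2.2.2 y h5, h4]
    · have := hmin y h3
      obtain rfl : p = y := by omega
      left; exact ⟨rfl, by omega⟩

theorem treeOf_card (ok : InvOK n s I) : (treeOf ok).card = I := by
  funext y x
  by_cases h : 1 ≤ x ∧ x < y ∧ y ≤ n
  swap
  · rw [SDecTree.card_out h, ok.out _ _ h]
  obtain ⟨h1, h2, h3⟩ := h
  have key : ∀ u w, 1 ≤ u → u ≤ n → 1 ≤ w → w ≤ n → (treeOf ok).LeftOf u w →
      ∃ z, u < z ∧ w < z ∧ I z u < I z w := by
    intro u w hu hu' hw hw' hl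
    obtain ⟨z, j₁, j₂, hz, h6, h7, h8⟩ := hl.pos
    rw [treeOf_inSub ok hz hu hu'] at h7
    rw [treeOf_inSub ok hz hw hw'] at h8
    exact ⟨z, h7.1.2.1, h8.1.2.1, by omega⟩
  rcases (treeOf ok).tri3 h1 h2 h3 with ⟨j, h⟩ | h | h
  · rw [SDecTree.card_of_inSub (by omega) h]
    rw [treeOf_inSub ok (by omega) h1 (by omega)] at h
    exact h.2.symm
  · rw [SDecTree.card_of_left (by omega) h]
    obtain ⟨z, h4, h5, h6⟩ := key _ _ h1 (by omega) (by omega) h3 h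
    have := ok.tr x y z h2 h5
    omega
  · rw [SDecTree.card_of_right h1 h2 h3 h]
    obtain ⟨z, h4, h5, h6⟩ := key _ _ (by omega) h3 h1 (by omega) h
    have := ok.pl x y z h2 h4
    omega

/-- `T^a ∖ 0` -/
def MM (n : ℕ) (I : ℕ → ℕ → ℕ) (a x : ℕ) : Prop := x = a ∨ (Anc n I x a ∧ 0 < I a x)

/-- tree ascents -/
structure TA (n : ℕ) (s : ℕ → ℕ) (I : ℕ → ℕ → ℕ) (a b : ℕ) : Prop where
  anc : Anc n I a b
  lt : I b a < s b
  mid : ∀ e, e < b → Anc n I a e → I e a = s e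
  leaf : ∀ x, Anc n I x a → 0 < s a → I a x < s a

theorem MM.le {a x : ℕ} (h : MM n I a x) : x ≤ a := by
  rcases h with h | h
  · omega
  · exact h.1.2.1.le

theorem MM.eq {a x z : ℕ} (h : MM n I a x) (hz : a < z) : I z x = I z a := by
  rcases h with h | h
  · rw [h]
  · exact h.1.2.2.2 z hz

/-- the multiplicity function of the rotation -/
noncomputable def rot (n : ℕ) (I : ℕ → ℕ → ℕ) (a b : ℕ) : ℕ → ℕ → ℕ := fun y x =>
  I y x + if y = b ∧ MM n I a x then 1 else 0

theorem rot_pos {a b x : ℕ} (h : MM n I a x) : rot n I a b b x = I b x + 1 := by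
  simp [rot, h]

theorem rot_neg {a b x : ℕ} (h : ¬ MM n I a x) (y : ℕ) : rot n I a b y x = I y x := by
  simp [rot, h]

theorem rot_ne {a b y : ℕ} (h : y ≠ b) (x : ℕ) : rot n I a b y x = I y x := by
  simp [rot, h]

/-- position of `q` relative to `a` -/
theorem TA.compare (ok : InvOK n s I) {a b q : ℕ} (h : TA n s I a b) (hq1 : 1 ≤ q) (hqb : q < b)
    (hI : I b q = I b a) :
    q = a ∨ Anc n I q a ∨ (Anc n I a q ∧ I q a = s q) ∨
      ∃ z, a < z ∧ q < z ∧ I z q < I z a := by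
  obtain ⟨⟨ha1, hab, hbn, hanc⟩, hlt, hmid, hleaf⟩ := h
  have key : ∀ z, a < z → q < z → Anc n I a z → I z q ≠ I z a → I z q < I z a := by
    intro z h1 h2 h3 h4
    by_contra hc
    rcases Nat.lt_trichotomy z b with h5 | h5 | h5
    · have := hmid z h5 h3
      have := ok.le z q
      omega
    · subst h5; exact h4 hI
    · have := hanc z h5
      have := ok.pl q b z hqb h5
      omega
  rcases Nat.lt_trichotomy q a with h1 | h1 | h1
  · rcases ok.lca hq1 h1 (by omega) with h2 | ⟨z, hz, h3, h4, h5⟩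
    · exact Or.inr (Or.inl h2)
    · exact Or.inr (Or.inr (Or.inr ⟨z, hz, by omega, key z hz (by omega) h4 h5⟩))
  · exact Or.inl h1
  · rcases ok.lca ha1 h1 (by omega) with h2 | ⟨z, hz, h3, h4, h5⟩
    · exact Or.inr (Or.inr (Or.inl ⟨h2, hmid q hqb h2⟩))
    · exact Or.inr (Or.inr (Or.inr ⟨z, by omega, hz, key z (by omega) hz h3 h5.symm⟩))

theorem rot_ok (ok : InvOK n s I) {a b : ℕ} (h : TA n s I a b) : InvOK n s (rot n I a b) := by
  have h' := h
  obtain ⟨⟨ha1, hab, hbn, hanc⟩, hlt, hmid, hleaf⟩ := h'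
  have hM1 : ∀ x, MM n I a x → 1 ≤ x := by
    rintro x (h | h)
    · omega
    · exact h.1.1
  constructor
  · intro y x hr
    have : ¬ (y = b ∧ MM n I a x) := by
      rintro ⟨rfl, hx⟩
      have := hM1 x hx
      have := hx.le
      omega
    simp only [rot, if_neg this]
    exact ok.out y x hr
  · intro y x
    by_cases hx : MM n I a x
    · by_cases hy : y = b
      · subst hy
        rw [rot_pos hx, hx.eq hab]
        omega
      · rw [rot_ne hy]; exact ok.le _ _
    · rw [rot_neg hx]; exact ok.le _ _
  · intro p q r hpq hqr
    by_cases hr : r = b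
    · subst hr
      rw [rot_ne (by omega : q ≠ r)]
      have htr := ok.tr p q r hpq hqr
      by_cases hp : MM n I a p
      · rw [rot_pos hp]
        by_cases hq : MM n I a q
        · rw [rot_pos hq]; omega
        · rw [rot_neg hq]; omega
      · rw [rot_neg hp]
        by_cases hq : MM n I a q
        · rw [rot_pos hq]
          by_contra hc
          have hq' := hq.eq hab
          have hqa := hq.le
          have hp1 : 1 ≤ p := by
            by_contra hp1
            have := ok.out q p (by omega)
            omega
          rcases h.compare ok hp1 (by omega) (by omega) with h1 | h1 | h1 | ⟨z, h1, h2, h3⟩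
          · omega
          · have h0 : I a p = 0 := by
              by_contra h0
              exact hp (Or.inr ⟨h1, by omega⟩)
            rcases hq with hq | hq
            · subst hq; omega
            · have := ok.tr p q a hpq hq.1.2.1
              omega
          · have := h1.1.2.1; omega
          · have := ok.tr p q z hpq (by omega)
            have := hq.eq h1
            omega
        · rw [rot_neg hq]; omega
    · rw [rot_ne hr, rot_ne hr]
      by_cases hq : q = b
      · by_cases hp : MM n I a p
        · right
          subst hq
          rw [hp.eq (by omega), hanc r hqr]
        · rw [rot_neg hp]; exact ok.tr p q r hpq hqr
      · rw [rot_ne hq]; exact ok.tr p q r hpq hqr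
  · intro p q r hpq hqr
    by_cases hr : r = b
    · subst hr
      rw [rot_ne (by omega : q ≠ r)]
      have htr := ok.pl p q r hpq hqr
      by_cases hp : MM n I a p
      · rw [rot_pos hp]
        by_cases hq : MM n I a q
        · rw [rot_pos hq]; omega
        · rw [rot_neg hq]
          by_contra hc
          have hp' := hp.eq hab
          have hpa := hp.le
          have hp1 := hM1 p hp
          rcases h.compare ok (q := q) (by omega) (by omega) (by omega) with
            h1 | h1 | h1 | ⟨z, h1, h2, h3⟩
          · exact hq (Or.inl h1)
          · have h0 : I a q = 0 := by
              by_contra h0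
              exact hq (Or.inr ⟨h1, by omega⟩)
            have h2 := h1.2.1
            rcases hp with hp | hp
            · omega
            · have := ok.pl p q a hpq h2
              omega
          · have := hp.eq h1.1.2.1
            omega
          · have := ok.pl p q z hpq (by omega)
            have := hp.eq h1
            omega
      · rw [rot_neg hp]
        by_cases hq : MM n I a q
        · rw [rot_pos hq]; omega
        · rw [rot_neg hq]; omega
    · rw [rot_ne hr, rot_ne hr]
      by_cases hq : q = b
      · by_cases hp : MM n I a p
        · right
          subst hq
          rw [hp.eq (by omega), hanc r hqr]
        · rw [rot_neg hp]; exact ok.pl p q r hpq hqr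
      · rw [rot_ne hq]; exact ok.pl p q r hpq hqr

theorem tc_eq_rot (ok : InvOK n s I) {a b : ℕ} (h : TA n s I a b) :
    tcInv (addInv s I b a) = rot n I a b := by
  have hab := h.anc.2.1
  have hlt := h.lt
  have hadd : ∀ y x, I y x ≤ addInv s I b a y x := by
    intro y x
    unfold addInv
    split_ifs with h1
    · obtain ⟨rfl, rfl⟩ := h1
      omega
    · exact le_rfl
  have hba : addInv s I b a b a = I b a + 1 := by
    simp only [addInv, and_self, if_true]
    omega
  have hmem : IsTransitiveInv (rot n I a b) ∧ ∀ y' x', addInv s I b a y' x' ≤ rot n I a b y' x' := by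
    refine ⟨(rot_ok ok h).tr, fun y x => ?_⟩
    unfold addInv
    split_ifs with h1
    · obtain ⟨rfl, rfl⟩ := h1
      rw [rot_pos (Or.inl rfl)]
      omega
    · simp [rot]
  funext y x
  apply le_antisymm
  · exact Nat.sInf_le ⟨_, hmem.1, hmem.2, rfl⟩
  · apply le_csInf
    · exact ⟨_, _, hmem.1, hmem.2, rfl⟩
    · rintro m ⟨J, hJ, hge, rfl⟩
      have h1 := fun y x => (hadd y x).trans (hge y x)
      by_cases hy : y = b
      swap
      · rw [rot_ne hy]; exact h1 y x
      subst hy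
      by_cases hx : MM n I a x
      swap
      · rw [rot_neg hx]; exact h1 y x
      rw [rot_pos hx, hx.eq hab]
      have h2 := hge y a
      rcases hx with rfl | hx
      · omega
      · have := hJ x a y hx.1.2.1 hab
        have := h1 a x
        omega

end functional

namespace SDecTree

variable {n : ℕ} {s : ℕ → ℕ}

theorem treeAscent_iff (T : SDecTree n s) {a b : ℕ} : T.TreeAscent a b ↔ TA n s T.card a b := by
  constructor
  · rintro ⟨h1, h2, h3, ⟨i, hi, h4⟩, h5, h6⟩
    rw [T.inSub_iff_anc (by omega)] at h4
    refine ⟨h4.1, by omega, fun e he hae => ?_, fun x hx hs => ?_⟩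
    · have := hae.2.1
      exact h5 e _ this he ((T.inSub_iff_anc (by omega)).2 ⟨hae, rfl⟩)
    · have := T.card_le a x
      have : T.card a x ≠ s a := fun hc => h6 hs x ((T.inSub_iff_anc h1).2 ⟨hx, hc⟩)
      omega
  · rintro ⟨h1, h2, h3, h4⟩
    obtain ⟨ha, hab, hbn, _⟩ := id h1
    refine ⟨ha, hab, hbn, ⟨_, h2, (T.inSub_iff_anc (by omega)).2 ⟨h1, rfl⟩⟩, ?_, ?_⟩
    · intro e j h5 h6 h7
      rw [T.inSub_iff_anc (by omega)] at h7
      rw [← h7.2]; exact h3 e h6 h7.1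
    · intro hs x hx
      rw [T.inSub_iff_anc ha] at hx
      have := h4 x hx.1 hs
      omega

theorem isRotation_iff (T Z : SDecTree n s) {a b : ℕ} :
    IsRotation T Z a b ↔ TA n s T.card a b ∧ Z.card = rot n T.card a b := by
  unfold IsRotation
  rw [treeAscent_iff]
  constructor
  · rintro ⟨h, h'⟩
    refine ⟨h, ?_⟩
    funext y x
    by_cases hr : 1 ≤ x ∧ x < y ∧ y ≤ n
    · rw [h' y x hr.1 hr.2.1 hr.2.2, tc_eq_rot T.ok h]
    · rw [card_out hr, (rot_ok T.ok h).out _ _ hr]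
  · rintro ⟨h, h'⟩
    refine ⟨h, fun y x _ _ _ => ?_⟩
    rw [h', tc_eq_rot T.ok h]

theorem rot_squeeze {T U : SDecTree n s} {a b : ℕ} (h : TA n s T.card a b) (h1 : wle T U)
    (h2 : ∀ y x, U.card y x ≤ rot n T.card a b y x) :
    U.card = T.card ∨ U.card = rot n T.card a b := by
  have hab := h.anc.2.1
  have hne : ∀ y, y ≠ b → ∀ x, U.card y x = T.card y x := by
    intro y hy x
    have := h1 y x
    have := h2 y x
    rw [rot_ne hy] at this
    omega
  have hnM : ∀ x, ¬ MM n T.card a x → ∀ y, U.card y x = T.card y x := by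
    intro x hx y
    have := h1 y x
    have := h2 y x
    rw [rot_neg hx] at this
    omega
  by_cases hba : U.card b a = T.card b a
  · left
    funext y x
    by_cases hy : y = b
    swap
    · exact hne y hy x
    subst hy
    by_cases hx : MM n T.card a x
    swap
    · exact hnM x hx y
    rcases id hx with rfl | hx'
    · exact hba
    have h3 := U.ok.pl x a y hx'.1.2.1 hab
    have h4 := hne a (by omega) x
    have h5 := T.card_le a x
    have h6 := h.leaf x hx'.1 (by omega)
    have h7 := hx.eq hab
    have h8 := h1 y x
    omega
  · right
    have hba' := h1 b a
    funext y x
    by_cases hy : y = b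
    swap
    · rw [rot_ne hy]; exact hne y hy x
    subst hy
    by_cases hx : MM n T.card a x
    swap
    · rw [rot_neg hx]; exact hnM x hx y
    have h2' := h2 y x
    rw [rot_pos hx] at h2' ⊢
    have h7 := hx.eq hab
    rcases hx with rfl | hx'
    · omega
    have h3 := U.ok.tr x a y hx'.1.2.1 hab
    have h4 := hne a (by omega) x
    omega

theorem wcov_of_rot {T Z : SDecTree n s} {a b : ℕ} (h : IsRotation T Z a b) : wcov T Z := by
  rw [isRotation_iff] at h
  obtain ⟨h, hZ⟩ := h
  refine ⟨⟨fun y x => ?_, fun hc => ?_⟩, ?_⟩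
  · rw [hZ]; simp [rot]
  · have := hc b a
    rw [hZ, rot_pos (Or.inl rfl)] at this
    omega
  · rintro U ⟨h1, h2⟩ ⟨h3, h4⟩
    rcases rot_squeeze h h1 (fun y x => hZ ▸ h3 y x) with h5 | h5
    · exact h2 fun y x => by rw [h5]
    · exact h4 fun y x => by rw [h5, hZ]

theorem exists_rot {T : SDecTree n s} {a b : ℕ} (h : TA n s T.card a b) :
    ∃ Z : SDecTree n s, IsRotation T Z a b :=
  ⟨treeOf (rot_ok T.ok h), (isRotation_iff _ _).2 ⟨h, treeOf_card _⟩⟩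

end SDecTree
/-- The configuration forced by the hypotheses. -/
theorem pentagon_config {n : ℕ} {s : ℕ → ℕ} {I : ℕ → ℕ → ℕ} (ok : InvOK n s I) {a b c d : ℕ}
    (hac : a < c) (hA : TA n s I a b) (hC : TA n s I c d)
    (hQa : TA n s (rot n I c d) a b) (hZc : ¬ TA n s (rot n I a b) c d) :
    b = c ∧ I c a + 1 = s c ∧ 0 < I c a := by
  have hbig : ∀ x, a < x → ∀ y, rot n I a b y x = I y x := by
    intro x hx y
    exact rot_neg (fun h => by have := h.le; omega) y
  obtain ⟨hc1, hcd, hdn, hcz⟩ := hC.anc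
  have hab := hA.anc.2.1
  have h1 : b = c ∧ I c a + 1 = s c := by
    by_contra hcon
    apply hZc
    refine ⟨⟨hc1, hcd, hdn, fun z hz => ?_⟩, ?_, fun e he hce => ?_, fun x hx hs => ?_⟩
    · rw [hbig c hac, hbig d (by omega)]; exact hcz z hz
    · rw [hbig c hac]; exact hC.lt
    · rw [hbig c hac]
      refine hC.mid e he ⟨hce.1, hce.2.1, hce.2.2.1, fun z hz => ?_⟩
      have h := hce.2.2.2 z hz
      rw [hbig c hac, hbig e (by have := hce.2.1; omega)] at h
      exact h
    · by_contra hlt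
      obtain ⟨hx1, hxc, hcn, hxz⟩ := hx
      have hnanc : ¬ (Anc n I x c ∧ I c x = s c) := by
        rintro ⟨h, h'⟩
        have := hC.leaf x h hs
        omega
      have hle := ok.le c x
      by_cases hx : MM n I a x
      swap
      · refine hnanc ⟨⟨hx1, hxc, hcn, fun z hz => ?_⟩, ?_⟩
        · have := hxz z hz
          rw [rot_neg hx, hbig c hac] at this
          exact this
        · rw [rot_neg hx] at hlt; omega
      rcases Nat.lt_trichotomy b c with hbc | hbc | hbc
      · refine hnanc ⟨⟨hx1, hxc, hcn, fun z hz => ?_⟩, ?_⟩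
        · have := hxz z hz
          rw [rot_ne (by omega), rot_ne (by omega)] at this
          exact this
        · rw [rot_ne (by omega)] at hlt; omega
      · subst hbc
        apply hcon
        refine ⟨rfl, ?_⟩
        rw [rot_pos hx, hx.eq hab] at hlt
        have := hA.lt
        omega
      · have h2 := hxz b hbc
        rw [rot_pos hx, hbig c hac] at h2
        rw [rot_ne (by omega)] at hlt
        have := ok.tr x c b hxc hbc
        omega
  obtain ⟨rfl, h2⟩ := h1
  refine ⟨rfl, h2, ?_⟩
  have h3 := hQa.anc.2.2.2 d hcd
  have h4 := hA.anc.2.2.2 d hcd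
  rw [rot_pos (x := b) (Or.inl rfl)] at h3
  by_contra h0
  have : ¬ MM n I b a := by
    rintro (h | h)
    · omega
    · omega
  rw [rot_neg this] at h3
  omega

theorem pentagon_interval_first (n : ℕ) (s : ℕ → ℕ) (T Z Q W : SDecTree n s)
    (a b c d : ℕ) (hac : a < c)
    (hZ : SDecTree.IsRotation T Z a b) (hQ : SDecTree.IsRotation T Q c d)
    (hQa : Q.TreeAscent a b) (hZc : ¬ Z.TreeAscent c d)
    (hW : SDecTree.IsJoin Z Q W) :
    ∃ P : SDecTree n s,
      {U : SDecTree n s | SDecTree.wle T U ∧ SDecTree.wle U W} = {T, Z, Q, P, W} ∧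
      (T ≠ Z ∧ T ≠ Q ∧ T ≠ P ∧ T ≠ W ∧ Z ≠ Q ∧ Z ≠ P ∧ Z ≠ W ∧ Q ≠ P ∧ Q ≠ W ∧ P ≠ W) ∧
      SDecTree.wcov T Z ∧ SDecTree.wcov Z P ∧ SDecTree.wcov P W ∧
      SDecTree.wcov T Q ∧ SDecTree.wcov Q W ∧
      SDecTree.IsRotation Z P a d ∧ SDecTree.IsRotation P W c d ∧
      SDecTree.IsRotation Q W a b := by
  have hZ0 := hZ
  have hQ0 := hQ
  rw [SDecTree.isRotation_iff] at hZ hQ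
  obtain ⟨hA, hZr⟩ := hZ
  obtain ⟨hC, hQr⟩ := hQ
  rw [SDecTree.treeAscent_iff] at hQa hZc
  have ok := T.ok
  obtain ⟨rfl, hs, hpos⟩ := pentagon_config ok hac hA hC (hQr ▸ hQa) (hZr ▸ hZc)
  -- from now on `b` plays the role of `c`
  obtain ⟨ha1, hab, hbn, haz⟩ := id hA.anc
  obtain ⟨hb1, hbd, hdn, hbz⟩ := id hC.anc
  generalize hI : T.card = I at *
  have hZf : ∀ y x, Z.card y x = I y x + if y = b ∧ MM n I a x then 1 else 0 := by
    intro y x; rw [hZr]; rfl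
  have hQf : ∀ y x, Q.card y x = I y x + if y = d ∧ MM n I b x then 1 else 0 := by
    intro y x; rw [hQr]; rfl
  have hMlt : ∀ x, a < x → ¬ MM n I a x := fun x hx h => by have := h.le; omega
  have hMa : MM n I a a := Or.inl rfl
  have hMb : MM n I b b := Or.inl rfl
  have hMsub : ∀ x, MM n I a x → MM n I b x := by
    intro x hx
    right
    have h1 : 1 ≤ x := by
      rcases hx with h | h
      · omega
      · exact h.1.1
    have h2 := hx.le
    refine ⟨⟨h1, by omega, hbn, fun z hz => ?_⟩, ?_⟩
    · rw [hx.eq (by omega), haz z hz]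
    · rw [hx.eq hab]; exact hpos
  have hMab := hMsub a hMa
  -- no vertex in the last slot of `b`
  have hleafb : ∀ x, 1 ≤ x → x < b → (∀ z, b < z → I z x = I z b) → I b x < s b :=
    fun x h1 h2 h3 => hC.leaf x ⟨h1, h2, hbn, h3⟩ (by omega)
  have hancZ : ∀ x, Anc n Z.card x a → Anc n I x a := by
    intro x hx
    by_cases hxM : MM n I a x
    · rcases hxM with h | h
      · have := hx.2.1; omega
      · exact h.1
    obtain ⟨hx1, hxa, hxn, hxz⟩ := hx
    refine ⟨hx1, hxa, hxn, fun z hz => ?_⟩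
    have h1 := hxz z hz
    simp only [hZf, hxM, hMa, and_true, and_false, if_false, add_zero] at h1
    by_cases hzb : z = b
    · exfalso
      subst hzb
      simp only [if_true] at h1
      have := hleafb x hx1 (by omega) (fun w hw => by
        have h2 := hxz w (by omega)
        simp only [hZf, hxM, hMa, and_true, and_false, if_false, add_zero,
          if_neg (by omega : ¬ w = z)] at h2
        rw [h2, haz w hw])
      omega
    · simp only [if_neg hzb] at h1
      omega
  have hMZ : ∀ x, MM n Z.card a x ↔ MM n I a x := by
    intro x
    constructor
    · rintro (h | ⟨h, h'⟩)
      · exact Or.inl h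
      · refine Or.inr ⟨hancZ x h, ?_⟩
        rw [hZf, if_neg (by omega)] at h'
        exact h'
    · intro hM
      rcases id hM with h | ⟨h, h'⟩
      · exact Or.inl h
      · refine Or.inr ⟨⟨h.1, h.2.1, h.2.2.1, fun z hz => ?_⟩, ?_⟩
        · simp only [hZf, hM, hMa, and_true]
          rw [h.2.2.2 z hz]
        · rw [hZf]; omega
  have hTAZ : TA n s Z.card a d := by
    refine ⟨⟨ha1, by omega, hdn, fun z hz => ?_⟩, ?_, fun e he hae => ?_, fun x hx hsa => ?_⟩
    · rw [hZf, hZf, if_neg (by omega), if_neg (by omega)]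
      rw [haz z (by omega), hbz z hz]
    · rw [hZf, if_neg (by omega), haz d hbd]
      exact hC.lt
    · obtain ⟨_, hlt, hen, hez⟩ := hae
      rw [hZf]
      rcases Nat.lt_trichotomy e b with h1 | h1 | h1
      · exfalso
        have h2 := hez b h1
        simp only [hZf, hMa, hMlt e hlt, and_true, and_false, if_true, if_false] at h2
        have := hleafb e (by omega) h1 (fun z hz => by
          have h3 := hez z (by omega)
          simp only [hZf, hMa, hMlt e hlt, and_true, and_false, if_false,
            if_neg (by omega : ¬ z = b)] at h3
          have := haz z hz
          omega)
        omega
      · subst h1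
        simp only [hMa, and_true, if_true]
        omega
      · rw [if_neg (by omega), haz e h1]
        refine hC.mid e he ⟨hb1, h1, hen, fun z hz => ?_⟩
        have h3 := hez z hz
        rw [hZf, hZf, if_neg (by omega), if_neg (by omega)] at h3
        have := haz z (by omega)
        omega
    · have := hA.leaf x (hancZ x hx) hsa
      rw [hZf, if_neg (by omega)]
      exact this
  obtain ⟨P, hP⟩ := SDecTree.exists_rot hTAZ
  have hPr := ((SDecTree.isRotation_iff _ _).1 hP).2
  have hPf : ∀ y x, P.card y x = I y x + (if y = b ∧ MM n I a x then 1 else 0)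
      + if y = d ∧ MM n I a x then 1 else 0 := by
    intro y x
    rw [hPr]
    simp only [rot, hMZ, hZf]
  have hPbig : ∀ x, a < x → ∀ y, P.card y x = I y x := by
    intro x hx y
    simp [hPf, hMlt x hx]
  have hancP : ∀ x, Anc n P.card x b ↔ (Anc n I x b ∧ ¬ MM n I a x) := by
    intro x
    constructor
    · rintro ⟨h1, h2, h3, h4⟩
      have hxM : ¬ MM n I a x := by
        intro hxM
        have h5 := h4 d hbd
        rw [hPbig b hab, hPf, if_neg (by omega), if_pos ⟨rfl, hxM⟩, hxM.eq (by omega),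
          haz d hbd] at h5
        omega
      refine ⟨⟨h1, h2, h3, fun z hz => ?_⟩, hxM⟩
      have h5 := h4 z hz
      simpa [hPbig b hab, hPf, hxM] using h5
    · rintro ⟨⟨h1, h2, h3, h4⟩, hxM⟩
      refine ⟨h1, h2, h3, fun z hz => ?_⟩
      simpa [hPbig b hab, hPf, hxM] using h4 z hz
  have hMP : ∀ x, MM n P.card b x ↔ (MM n I b x ∧ ¬ MM n I a x) := by
    intro x
    constructor
    · rintro (h | ⟨h, h'⟩)
      · exact ⟨Or.inl h, hMlt x (by omega)⟩
      · rw [hancP] at h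
        refine ⟨Or.inr ⟨h.1, ?_⟩, h.2⟩
        simpa [hPf, h.2] using h'
    · rintro ⟨h | ⟨h, h'⟩, h2⟩
      · exact Or.inl h
      · refine Or.inr ⟨(hancP x).2 ⟨h, h2⟩, ?_⟩
        simpa [hPf, h2] using h'
  have hTAP : TA n s P.card b d := by
    refine ⟨⟨hb1, hbd, hdn, fun z hz => ?_⟩, ?_, fun e he hbe => ?_, fun x hx hsb => ?_⟩
    · rw [hPbig b hab, hPbig d (by omega)]; exact hbz z hz
    · rw [hPbig b hab]; exact hC.lt
    · rw [hPbig b hab]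
      refine hC.mid e he ⟨hbe.1, hbe.2.1, hbe.2.2.1, fun z hz => ?_⟩
      have := hbe.2.2.2 z hz
      rwa [hPbig b hab, hPbig e (by have := hbe.2.1; omega)] at this
    · have hx' := (hancP x).1 hx
      have := hC.leaf x hx'.1 hsb
      simpa [hPf, hx'.2] using this
  obtain ⟨W', hW'⟩ := SDecTree.exists_rot hTAP
  have hWr := ((SDecTree.isRotation_iff _ _).1 hW').2
  have hWf : ∀ y x, W'.card y x = I y x + (if y = b ∧ MM n I a x then 1 else 0)
      + if y = d ∧ MM n I b x then 1 else 0 := by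
    intro y x
    rw [hWr]
    simp only [rot, hMP, hPf]
    have := hMsub x
    by_cases h1 : MM n I a x
    · simp [h1, this h1]
    · simp [h1]
  have hWW : W = W' := by
    apply SDecTree.ext_card
    funext y x
    apply le_antisymm
    · refine hW.2.2 W' (fun y x => ?_) (fun y x => ?_) y x
      · rw [hZf, hWf]; omega
      · rw [hQf, hWf]; omega
    · have h1 := hW.1 y x
      have h2 := hW.2.1 y x
      rw [hZf] at h1
      rw [hQf] at h2
      rw [hWf]
      split_ifs at * <;> omega
  subst hWW
  have hMQ : ∀ x, MM n Q.card a x ↔ MM n I a x := by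
    intro x
    have hQa' : ∀ y, Q.card y a = I y a + if y = d then 1 else 0 := by
      intro y; simp [hQf, hMab]
    constructor
    · rintro (h | ⟨⟨h1, h2, h3, h4⟩, h'⟩)
      · exact Or.inl h
      · rw [hQf, if_neg (by omega)] at h'
        have hxb := h4 b hab
        rw [hQa', hQf, if_neg (by omega), if_neg (by omega)] at hxb
        have hxM : MM n I b x := by
          by_contra hxM
          have h5 := h4 d (by omega)
          rw [hQa', hQf, if_neg (by tauto), if_pos rfl, haz d hbd] at h5
          have := ok.pl x b d (by omega) hbd
          omega
        refine Or.inr ⟨⟨h1, h2, h3, fun z hz => ?_⟩, h'⟩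
        have h5 := h4 z hz
        simp only [hQa', hQf, hxM, and_true] at h5
        omega
    · intro hM
      rcases id hM with h | ⟨h, h'⟩
      · exact Or.inl h
      · refine Or.inr ⟨⟨h.1, h.2.1, h.2.2.1, fun z hz => ?_⟩, ?_⟩
        · simp only [hQa', hQf, hMsub x hM, and_true]
          rw [h.2.2.2 z hz]
        · rw [hQf]; omega
  have hQW : SDecTree.IsRotation Q W a b := by
    rw [SDecTree.isRotation_iff]
    refine ⟨hQa, ?_⟩
    funext y x
    simp only [rot, hMQ, hWf, hQf]
    omega
  have hne : ∀ {U V : SDecTree n s} (y x : ℕ), U.card y x ≠ V.card y x → U ≠ V := by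
    rintro U V y x h rfl
    exact h rfl
  have hbM := hMlt b hab
  have hbd' : b ≠ d := by omega
  have hdb' : d ≠ b := by omega
  refine ⟨P, ?_, ⟨hne b a ?_, hne d b ?_, hne b a ?_, hne b a ?_, hne b a ?_, hne d a ?_, hne d a ?_,
    hne d b ?_, hne b a ?_, hne d b ?_⟩, SDecTree.wcov_of_rot hZ0, SDecTree.wcov_of_rot hP,
    SDecTree.wcov_of_rot hW', SDecTree.wcov_of_rot hQ0, SDecTree.wcov_of_rot hQW, hP, hW', hQW⟩
  rotate_left
  iterate 10 simp [hI, hZf, hQf, hPf, hWf, hMa, hMb, hMab, hbM, hbd', hdb']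
  ext U
  simp only [Set.mem_ofPred_eq, Set.mem_insert_iff, Set.mem_singleton_iff]
  constructor
  swap
  · rintro (rfl | rfl | rfl | rfl | rfl)
    all_goals
      refine ⟨fun y x => ?_, fun y x => ?_⟩
    all_goals
      try simp only [hI, hZf, hQf, hPf, hWf]
    all_goals
      have := hMsub x
      first | exact le_rfl | (split_ifs <;> first | omega | tauto)
  rintro ⟨hl, hu⟩
  have hl : ∀ y x, I y x ≤ U.card y x := fun y x => by rw [← hI]; exact hl y x
  have hu : ∀ y x, U.card y x ≤ I y x + (if y = b ∧ MM n I a x then 1 else 0)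
      + if y = d ∧ MM n I b x then 1 else 0 := fun y x => by rw [← hWf]; exact hu y x
  have uo := U.ok
  have hUa : ∀ x, U.card a x = I a x := by
    intro x
    have h1 := hl a x
    have h2 := hu a x
    rw [if_neg (by omega), if_neg (by omega)] at h2
    omega
  -- all or nothing on `MM a`, at any `y` above
  have hall : ∀ y, b ≤ y → ∀ x, MM n I a x → U.card y x ≤ I y x + 1 →
      U.card y a ≤ I y a + 1 → U.card y x - I y x = U.card y a - I y a := by
    intro y hy x hx hle hle'
    have h1 := hl y x
    have h2 := hl y a
    have h3 := hx.eq (z := y) (by omega)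
    rcases hx with rfl | ⟨hx, hx'⟩
    · rfl
    · have h4 := uo.tr x a y hx.2.1 (by omega)
      have h5 := uo.pl x a y hx.2.1 (by omega)
      have h6 := hUa x
      have h7 := ok.le a x
      have h8 := hA.leaf x hx (by omega)
      omega
  have hub : ∀ x, U.card b x ≤ I b x + 1 := by
    intro x
    have := hu b x
    rw [if_neg (by omega : ¬ (b = d ∧ _))] at this
    split_ifs at this <;> omega
  have hud : ∀ x, U.card d x ≤ I d x + 1 := by
    intro x
    have := hu d x
    rw [if_neg (by omega : ¬ (d = b ∧ _))] at this
    split_ifs at this <;> omega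
  have hallb := fun x hx => hall b le_rfl x hx (hub x) (hub a)
  have halld := fun x hx => hall d hbd.le x hx (hud x) (hud a)
  have hother : ∀ y x, ¬ (y = b ∧ MM n I a x) → ¬ (y = d ∧ MM n I b x) → U.card y x = I y x := by
    intro y x h1 h2
    have h3 := hl y x
    have h4 := hu y x
    rw [if_neg h1, if_neg h2] at h4
    omega
  have e3 : U.card d b ≠ I d b → ∀ x, MM n I b x → U.card d x = I d x + 1 := by
    intro h x hx
    have h1 := hl d x
    have h2 := hl d b
    have h3 := hud x
    have h4 := hx.eq hbd
    rcases hx with rfl | ⟨hx, hx'⟩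
    · omega
    · have := uo.tr x b d hx.2.1 hbd
      have := hl b x
      omega
  have e4 : U.card d b = I d b → ∀ x, MM n I b x → U.card d x ≠ I d x →
      MM n I a x ∧ U.card b x = I b x + 1 := by
    intro h x hx hne
    have h1 := hl d x
    have h4 := hx.eq hbd
    rcases hx with rfl | ⟨hx, hx'⟩
    · omega
    · have h5 := uo.pl x b d hx.2.1 hbd
      have h6 := hl b x
      have h7 := hC.leaf x hx (by omega)
      have h8 : U.card b x = I b x + 1 := by have := hub x; omega
      refine ⟨?_, h8⟩
      by_contra hxM
      have := hother b x (by tauto) (by omega)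
      omega
  have fin : ∀ V : SDecTree n s, (∀ x, MM n I a x → U.card b x = V.card b x) →
      (∀ x, MM n I b x → U.card d x = V.card d x) →
      (∀ y x, ¬ (y = b ∧ MM n I a x) → ¬ (y = d ∧ MM n I b x) → V.card y x = I y x) → U = V := by
    intro V h1 h2 h3
    apply SDecTree.ext_card
    funext y x
    by_cases h4 : y = b ∧ MM n I a x
    · obtain ⟨rfl, h4⟩ := h4; exact h1 x h4
    by_cases h5 : y = d ∧ MM n I b x
    · obtain ⟨rfl, h5⟩ := h5; exact h2 x h5
    rw [hother y x h4 h5, h3 y x h4 h5]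
  by_cases cb : U.card d b = I d b
  · by_cases ca : U.card b a = I b a
    · left
      apply fin
      · intro x hx
        have := hallb x hx
        have := hl b x
        rw [hI]; omega
      · intro x hx
        rw [hI]
        by_contra hne
        obtain ⟨h1, h2⟩ := e4 cb x hx hne
        have := hallb x h1
        omega
      · intro y x _ _; rw [hI]
    · have ca' := hl b a
      by_cases da : U.card d a = I d a
      · right; left
        apply fin
        · intro x hx
          have := hallb x hx
          have := hub x
          rw [hZf, if_pos ⟨rfl, hx⟩]; omega
        · intro x hx
          rw [hZf, if_neg (by omega)]
          by_contra hne
          obtain ⟨h1, h2⟩ := e4 cb x hx hne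
          have := halld x h1
          have := hl d x
          omega
        · intro y x h1 h2; rw [hZf, if_neg h1]; rfl
      · have da' := hl d a
        right; right; right; left
        apply fin
        · intro x hx
          have := hallb x hx
          have := hub x
          rw [hPf, if_pos ⟨rfl, hx⟩, if_neg (by omega)]; omega
        · intro x hx
          rw [hPf, if_neg (by omega)]
          by_cases hxa : MM n I a x
          · have := halld x hxa
            have := hud x
            rw [if_pos ⟨rfl, hxa⟩]; omega
          · rw [if_neg (by tauto)]
            by_contra hne
            exact hxa (e4 cb x hx hne).1
        · intro y x h1 h2
          have := hMsub x
          rw [hPf, if_neg h1, if_neg (by tauto)]; rfl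
  · have e3 := e3 cb
    by_cases ca : U.card b a = I b a
    · right; right; left
      apply fin
      · intro x hx
        have := hallb x hx
        have := hl b x
        rw [hQf, if_neg (by omega)]; omega
      · intro x hx
        rw [hQf, if_pos ⟨rfl, hx⟩]; exact e3 x hx
      · intro y x h1 h2; rw [hQf, if_neg h2]; rfl
    · have ca' := hl b a
      right; right; right; right
      apply fin
      · intro x hx
        have := hallb x hx
        have := hub x
        rw [hWf, if_pos ⟨rfl, hx⟩, if_neg (by omega)]; omega
      · intro x hx
        rw [hWf, if_neg (by omega), if_pos ⟨rfl, hx⟩]; exact e3 x hx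
      · intro y x h1 h2; rw [hWf, if_neg h1, if_neg h2]; rfl
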